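/- Let T be a nice treedepth decomposition of a graph G, let x be a node of T with set of children C, and let C' ⊆ C. Let T_x^{C'} be the tree obtained from the subtree T_x rooted at x by deleting the subtrees rooted at the children in C \ C'. Then the subgraph of G induced by the nodes of T_x^{C'} is connected. -/

import Mathlib

/-- A rooted forest on vertex type `V`, given by a parent function together with
a depth function certifying acyclicity (roots have depth 1). -/
structure RootedForest (V : Type) where
  parent : V → Option V
  depth : V → ℕ
  depth_root : ∀ v, parent v = none → depth v = 1
  depth_child : ∀ v u, parent v = some u → depth v = depth u + 1

namespace RootedForest

variable {V : Type}

/-- `F.Ancestor u v` : `u` is a strict ancestor of `v` in the forest `F`. -/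
def Ancestor (F : RootedForest V) (u v : V) : Prop :=
  Relation.TransGen (fun a b : V => F.parent a = some b) v u

/-- Height of the forest: the maximum number of nodes on a root-to-leaf path,
equivalently the maximum depth of a node. -/
noncomputable def height (F : RootedForest V) : ℕ :=
  sSup (Set.range F.depth)

/-- The node set of the subtree of `F` rooted at `x` (including `x` itself). -/
def subtreeSet (F : RootedForest V) (x : V) : Set V :=
  {v | v = x ∨ F.Ancestor x v}

/-- `F` is a treedepth decomposition of `G`: every edge of `G` joins an
ancestor-descendant pair of `F`. -/
def IsTreedepthDecomp (F : RootedForest V) (G : SimpleGraph V) : Prop :=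
  ∀ ⦃u v⦄, G.Adj u v → F.Ancestor u v ∨ F.Ancestor v u

end RootedForest

/-- The treedepth of `G`: the minimum height of a treedepth decomposition of `G`. -/
noncomputable def SimpleGraph.treedepth {V : Type} (G : SimpleGraph V) : ℕ :=
  sInf {h | ∃ F : RootedForest V, F.IsTreedepthDecomp G ∧ F.height = h}

namespace RootedForest

variable {V : Type} {F : RootedForest V}

theorem mem_subtreeSet_iff {x v : V} :
    v ∈ F.subtreeSet x ↔ Relation.ReflTransGen (fun a b : V => F.parent a = some b) v x := by
  rw [Relation.reflTransGen_iff_eq_or_transGen]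
  simp [subtreeSet, Ancestor, eq_comm]

theorem Ancestor.depth_lt {u v : V} (h : F.Ancestor u v) : F.depth u < F.depth v := by
  induction h with
  | single h => have := F.depth_child _ _ h; omega
  | tail _ h ih => have := F.depth_child _ _ h; omega

theorem subtreeSet_subset_of_parent {c x : V} (h : F.parent c = some x) :
    F.subtreeSet c ⊆ F.subtreeSet x := fun _ hv =>
  mem_subtreeSet_iff.2 ((mem_subtreeSet_iff.1 hv).tail h)

theorem notMem_subtreeSet_of_parent {c x : V} (h : F.parent c = some x) :
    x ∉ F.subtreeSet c := by
  have := F.depth_child _ _ h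
  rintro (rfl | hx)
  · omega
  · have := hx.depth_lt
    omega

/-- The only vertex of the subtree at `x` that is a neighbour of, but does not lie in,
the subtree at a child of `x`, is `x` itself. -/
theorem IsTreedepthDecomp.eq_of_adj {G : SimpleGraph V} (hF : F.IsTreedepthDecomp G)
    {c x a b : V} (hc : F.parent c = some x) (hab : G.Adj a b)
    (ha : a ∈ F.subtreeSet c) (hb : b ∈ F.subtreeSet x) (hbc : b ∉ F.subtreeSet c) :
    b = x := by
  rw [mem_subtreeSet_iff] at ha hbc
  rcases hF hab with h | h
  · exact absurd (h.to_reflTransGen.trans ha) hbc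
  · have huniq : Relator.RightUnique (fun a b : V => F.parent a = some b) :=
      fun _ _ _ h₁ h₂ => Option.some.inj (h₁.symm.trans h₂)
    rcases Relation.ReflTransGen.total_of_right_unique huniq ha h.to_reflTransGen with h' | h'
    · rcases Relation.ReflTransGen.cases_head h' with rfl | ⟨d, hd, hdb⟩
      · exact absurd .refl hbc
      · obtain rfl : x = d := huniq hc hd
        rcases hb with hb | hb
        · exact hb
        · rcases mem_subtreeSet_iff.2 hdb with h'' | h''
          · exact h''.symm
          · exact absurd hb.depth_lt h''.depth_lt.asymm
    · exact absurd h' hbc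

/-- If the subtree at `x` is connected, `x` has a neighbour in the subtree at each child. -/
theorem IsTreedepthDecomp.exists_adj_of_parent {G : SimpleGraph V}
    (hF : F.IsTreedepthDecomp G) {c x : V} (hc : F.parent c = some x)
    (hx : (G.induce (F.subtreeSet x)).Connected) :
    ∃ a ∈ F.subtreeSet c, G.Adj x a := by
  obtain ⟨p⟩ := hx.preconnected ⟨c, subtreeSet_subset_of_parent hc (Or.inl rfl)⟩ ⟨x, Or.inl rfl⟩
  obtain ⟨d, -, h₁, h₂⟩ := p.exists_boundary_dart {v | v.1 ∈ F.subtreeSet c}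
    (Or.inl rfl) (notMem_subtreeSet_of_parent hc)
  have hadj : G.Adj d.fst.1 d.snd.1 := d.adj
  refine ⟨d.fst.1, h₁, ?_⟩
  rw [hF.eq_of_adj hc hadj h₁ d.snd.2 h₂] at hadj
  exact hadj.symm

end RootedForest

/-- Let `T` be a nice treedepth decomposition of `G`, let `x` be a node of `T` and let
`C'` be a subset of the children of `x`.  Then the subgraph of `G` induced by the nodes of
the tree `T_x^{C'}` (consisting of `x` together with the subtrees rooted at the children
in `C'`) is connected. -/
theorem stmt7 {V : Type} [Fintype V] (G : SimpleGraph V) (T : RootedForest V)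
    (hT : T.IsTreedepthDecomp G)
    (hnice : ∀ z : V, (G.induce (T.subtreeSet z)).Connected)
    (x : V) (C' : Set V) (hC' : ∀ c ∈ C', T.parent c = some x) :
    (G.induce ({x} ∪ ⋃ c ∈ C', T.subtreeSet c)).Connected := by
  refine SimpleGraph.induce_connected_of_patches x (Or.inl rfl) fun {v} hv => ?_
  rcases hv with rfl | hv
  · exact ⟨{v}, Set.subset_union_left, rfl, rfl, .rfl⟩
  · obtain ⟨c, hc, hvc⟩ := Set.mem_iUnion₂.1 hv
    obtain ⟨a, ha, hxa⟩ := hT.exists_adj_of_parent (hC' c hc) (hnice x)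
    have hconn : (G.induce ({x} ∪ T.subtreeSet c)).Connected :=
      G.connected_induce_union .of_subsingleton (hnice c).preconnected rfl ha hxa
    exact ⟨_, Set.union_subset_union_right _ (Set.subset_biUnion_of_mem hc),
      Or.inl rfl, Or.inr hvc, hconn.preconnected _ _⟩
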